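/- Let A_1,…,A_m and c be real symmetric n×n matrices, b ∈ ℝ^m, θ ∈ ℝ, and ε ∈ (0,1). Suppose y* ∈ ℝ^m and ν* ≥ 0 are dual feasible, i.e. ∑_{i≤m} y*_i A_i − ν*·I ⪯ c. Let T ∈ ℝ^{d×m} be a matrix satisfying ⟨Tb, Ty*⟩ ≥ bᵀy* − ε‖b‖₂‖y*‖₂ and ‖TᵀT y* − y*‖_∞ ≤ ε‖y*‖₂, and set μ := ε‖y*‖₂·‖Aᵀ‖. Then there exist z ∈ ℝ^d and ν ≥ 0 such that ∑_{i≤m} (Tᵀz)_i A_i − ν·I ⪯ c + μ·I and (Tb)ᵀz − θν ≥ (bᵀy* − θν*) − ε‖b‖₂‖y*‖₂; in particular the relaxed projected dual problem has a feasible solution of value at least the dual value bᵀy* − θν* minus ε‖b‖₂‖y*‖₂. -/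

import Mathlib

open MeasureTheory Pointwise

/-- Euclidean (ℓ2) norm of a vector in ℝ^k. -/
noncomputable def norm2 {k : ℕ} (x : Fin k → ℝ) : ℝ := Real.sqrt (∑ i, (x i) ^ 2)

/-- Supremum (ℓ∞) norm of a vector in ℝ^k. -/
noncomputable def normInf {k : ℕ} (x : Fin k → ℝ) : ℝ := ⨆ i, |x i|

/-- Standard Euclidean inner product on ℝ^k. -/
def dotp {k : ℕ} (x y : Fin k → ℝ) : ℝ := ∑ i, x i * y i

/-- ℓ2 operator (spectral) norm of a matrix. -/
noncomputable def specNorm {p q : ℕ} (M : Matrix (Fin p) (Fin q) ℝ) : ℝ :=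
  ⨆ u : {u : Fin q → ℝ // norm2 u ≤ 1}, norm2 (M.mulVec u.1)

/-- ‖Aᵀ‖ := sup { ‖∑ i, y i • A i‖₂ : ‖y‖_∞ ≤ 1 }. -/
noncomputable def ATnorm {n m : ℕ} (A : Fin m → Matrix (Fin n) (Fin n) ℝ) : ℝ :=
  ⨆ y : {y : Fin m → ℝ // normInf y ≤ 1}, specNorm (∑ i, y.1 i • A i)

/-- Smallest eigenvalue of a real symmetric matrix, via the Rayleigh quotient. -/
noncomputable def lambdaMin {n : ℕ} (M : Matrix (Fin n) (Fin n) ℝ) : ℝ :=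
  ⨅ u : {u : Fin n → ℝ // u ≠ 0}, dotp u.1 (M.mulVec u.1) / (∑ i, (u.1 i) ^ 2)

/-- Largest eigenvalue of a real symmetric matrix, via the Rayleigh quotient. -/
noncomputable def lambdaMax {n : ℕ} (M : Matrix (Fin n) (Fin n) ℝ) : ℝ :=
  ⨆ u : {u : Fin n → ℝ // u ≠ 0}, dotp u.1 (M.mulVec u.1) / (∑ i, (u.1 i) ^ 2)

/-- Loewner order: X ⪯ Y iff Y - X is positive semidefinite. -/
def PSDle {n : ℕ} (X Y : Matrix (Fin n) (Fin n) ℝ) : Prop := (Y - X).PosSemidef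

/-- Frobenius norm of a matrix. -/
noncomputable def frobNorm {n : ℕ} (X : Matrix (Fin n) (Fin n) ℝ) : ℝ :=
  Real.sqrt (∑ i, ∑ j, (X i j) ^ 2)

/-- A random matrix `T : Ω → ℝ^{d×m}` is a random projection with constants `c, C` if
for every `ε ∈ (0,1)` and `x ∈ ℝ^m`, `(1-ε)‖x‖² ≤ ‖Tx‖² ≤ (1+ε)‖x‖²` holds with
probability at least `1 - c·exp(-C ε² d)`. -/
def IsRandomProjection {Ω : Type*} [MeasurableSpace Ω] (μ : Measure Ω) {d m : ℕ}
    (T : Ω → Matrix (Fin d) (Fin m) ℝ) (c C : ℝ) : Prop :=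
  ∀ ε ∈ Set.Ioo (0 : ℝ) 1, ∀ x : Fin m → ℝ,
    1 - c * Real.exp (-C * ε ^ 2 * d) ≤
      (μ {ω | (1 - ε) * (norm2 x) ^ 2 ≤ (norm2 ((T ω).mulVec x)) ^ 2 ∧
              (norm2 ((T ω).mulVec x)) ^ 2 ≤ (1 + ε) * (norm2 x) ^ 2}).toReal

/-- Gaussian width of a set `S ⊆ ℝ^k`. -/
noncomputable def gaussWidth {k : ℕ} (S : Set (Fin k → ℝ)) : ℝ :=
  ∫ g, (⨆ x : S, dotp g x.1) ∂(Measure.pi fun _ : Fin k => ProbabilityTheory.gaussianReal 0 1)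

/-- Radius (w.r.t. the Euclidean norm) of a set `S ⊆ ℝ^k`. -/
noncomputable def rad2 {k : ℕ} (S : Set (Fin k → ℝ)) : ℝ := ⨆ x : S, norm2 x.1

/-- Diameter (w.r.t. the Euclidean norm) of a set `S ⊆ ℝ^k`. -/
noncomputable def diam2 {k : ℕ} (S : Set (Fin k → ℝ)) : ℝ :=
  ⨆ p : ↥(S ×ˢ S), norm2 (p.1.1 - p.1.2)

lemma aux_norm2_nonneg {k : ℕ} (x : Fin k → ℝ) : 0 ≤ norm2 x := Real.sqrt_nonneg _

lemma aux_norm2_sq {k : ℕ} (x : Fin k → ℝ) : norm2 x ^ 2 = ∑ i, (x i) ^ 2 :=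
  Real.sq_sqrt (Finset.sum_nonneg fun i _ => sq_nonneg _)

lemma aux_norm2_smul {k : ℕ} (a : ℝ) (ha : 0 ≤ a) (x : Fin k → ℝ) :
    norm2 (a • x) = a * norm2 x := by
  unfold norm2
  simp only [Pi.smul_apply, smul_eq_mul, mul_pow]
  rw [← Finset.mul_sum, Real.sqrt_mul (sq_nonneg a), Real.sqrt_sq ha]

lemma aux_norm2_le {k : ℕ} (x : Fin k → ℝ) : norm2 x ≤ ∑ i, |x i| := by
  have h0 : 0 ≤ ∑ i, |x i| := Finset.sum_nonneg fun i _ => abs_nonneg _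
  refine Real.sqrt_le_iff.2 ⟨h0, ?_⟩
  have := Finset.sum_sq_le_sq_sum_of_nonneg (s := Finset.univ) (f := fun i => |x i|)
    (fun i _ => abs_nonneg _)
  simpa using this

lemma aux_abs_le {k : ℕ} (x : Fin k → ℝ) (i : Fin k) : |x i| ≤ norm2 x := by
  refine Real.abs_le_sqrt ?_
  exact Finset.single_le_sum (f := fun i => x i ^ 2) (fun i _ => sq_nonneg _) (Finset.mem_univ i)

lemma aux_abs_le_inf {k : ℕ} (x : Fin k → ℝ) (i : Fin k) : |x i| ≤ normInf x :=
  le_ciSup (f := fun i => |x i|) (Set.finite_range _).bddAbove i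

lemma aux_bound {n : ℕ} (M : Matrix (Fin n) (Fin n) ℝ) (u : Fin n → ℝ) (hu : norm2 u ≤ 1) :
    norm2 (M.mulVec u) ≤ ∑ i, ∑ j, |M i j| := by
  refine (aux_norm2_le _).trans (Finset.sum_le_sum fun i _ => ?_)
  refine (Finset.abs_sum_le_sum_abs (fun j => M i j * u j) Finset.univ).trans
    (Finset.sum_le_sum fun j _ => ?_)
  rw [abs_mul]
  exact mul_le_of_le_one_right (abs_nonneg _) ((aux_abs_le u j).trans hu)

lemma aux_le_spec {n : ℕ} (M : Matrix (Fin n) (Fin n) ℝ) (u : Fin n → ℝ) (hu : norm2 u ≤ 1) :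
    norm2 (M.mulVec u) ≤ specNorm M := by
  refine le_ciSup (f := fun u : {u : Fin n → ℝ // norm2 u ≤ 1} => norm2 (M.mulVec u.1)) ?_ ⟨u, hu⟩
  refine ⟨∑ i, ∑ j, |M i j|, ?_⟩
  rintro _ ⟨v, rfl⟩
  exact aux_bound M v.1 v.2

lemma aux_spec_le {n : ℕ} (M : Matrix (Fin n) (Fin n) ℝ) :
    specNorm M ≤ ∑ i, ∑ j, |M i j| := by
  haveI : Nonempty {u : Fin n → ℝ // norm2 u ≤ 1} := ⟨⟨0, by simp [norm2]⟩⟩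
  exact ciSup_le fun v => aux_bound M v.1 v.2

lemma aux_le_AT {n m : ℕ} (A : Fin m → Matrix (Fin n) (Fin n) ℝ) (y : Fin m → ℝ)
    (hy : normInf y ≤ 1) : specNorm (∑ i, y i • A i) ≤ ATnorm A := by
  refine le_ciSup (f := fun y : {y : Fin m → ℝ // normInf y ≤ 1} =>
    specNorm (∑ i, y.1 i • A i)) ?_ ⟨y, hy⟩
  refine ⟨∑ i, ∑ j, ∑ k, |A k i j|, ?_⟩
  rintro _ ⟨v, rfl⟩
  refine (aux_spec_le _).trans (Finset.sum_le_sum fun i _ => Finset.sum_le_sum fun j _ => ?_)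
  simp only [Matrix.sum_apply, Matrix.smul_apply, smul_eq_mul]
  refine (Finset.abs_sum_le_sum_abs _ _).trans (Finset.sum_le_sum fun k _ => ?_)
  rw [abs_mul]
  exact mul_le_of_le_one_left (abs_nonneg _) ((aux_abs_le_inf _ k).trans v.2)

lemma aux_cs {k : ℕ} (x y : Fin k → ℝ) : x ⬝ᵥ y ≤ norm2 x * norm2 y :=
  Real.sum_mul_le_sqrt_mul_sqrt _ _ _

lemma aux_quad {n : ℕ} (M : Matrix (Fin n) (Fin n) ℝ) (u : Fin n → ℝ) :
    u ⬝ᵥ M.mulVec u ≤ specNorm M * norm2 u ^ 2 := by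
  have h0 := aux_norm2_nonneg u
  rcases h0.eq_or_lt with h | h
  · have := aux_cs u (M.mulVec u)
    rw [← h] at this ⊢
    simpa using this
  · have hv : norm2 ((norm2 u)⁻¹ • u) ≤ 1 := by
      rw [aux_norm2_smul _ (inv_nonneg.2 h0), inv_mul_cancel₀ h.ne']
    have h1 := aux_le_spec M _ hv
    rw [Matrix.mulVec_smul, aux_norm2_smul _ (inv_nonneg.2 h0), inv_mul_le_iff₀ h] at h1
    have := aux_cs u (M.mulVec u)
    nlinarith [mul_le_mul_of_nonneg_left h1 h0]

lemma aux_main {n m : ℕ} (A : Fin m → Matrix (Fin n) (Fin n) ℝ) (w : Fin m → ℝ) (r : ℝ)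
    (hr : 0 ≤ r) (hw : normInf w ≤ r) (u : Fin n → ℝ) :
    u ⬝ᵥ (∑ i, w i • A i).mulVec u ≤ r * ATnorm A * norm2 u ^ 2 := by
  rcases hr.eq_or_lt with h | h
  · have hz : ∀ i, w i = 0 := fun i =>
      abs_nonpos_iff.1 ((aux_abs_le_inf w i).trans (hw.trans h.symm.le))
    simp [hz, ← h]
  · have hy : normInf (r⁻¹ • w) ≤ 1 := by
      refine Real.iSup_le (fun i => ?_) zero_le_one
      rw [Pi.smul_apply, smul_eq_mul, abs_mul, abs_of_pos (inv_pos.2 h), inv_mul_le_iff₀ h, mul_one]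
      exact (aux_abs_le_inf w i).trans hw
    have h1 := aux_le_AT A _ hy
    have h2 := aux_quad (∑ i, (r⁻¹ • w) i • A i) u
    have h3 : ∑ i, w i • A i = r • ∑ i, (r⁻¹ • w) i • A i := by
      rw [Finset.smul_sum]
      refine Finset.sum_congr rfl fun i _ => ?_
      rw [smul_smul, Pi.smul_apply, smul_eq_mul, mul_inv_cancel_left₀ h.ne']
    rw [h3, Matrix.smul_mulVec, dotProduct_smul, smul_eq_mul, mul_assoc]
    refine mul_le_mul_of_nonneg_left (h2.trans ?_) hr
    exact mul_le_mul_of_nonneg_right h1 (sq_nonneg _)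

/-- From a dual feasible (y*, ν*) one obtains a feasible solution of the relaxed
projected dual (with μ = ε‖y*‖₂‖Aᵀ‖) whose objective value is at least
(bᵀy* − θν*) − ε‖b‖₂‖y*‖₂. -/
theorem stmt_6 {n m d : ℕ} (A : Fin m → Matrix (Fin n) (Fin n) ℝ)
    (hA : ∀ i, (A i).IsSymm) (c : Matrix (Fin n) (Fin n) ℝ) (hc : c.IsSymm)
    (b : Fin m → ℝ) (θ : ℝ) (ε : ℝ) (hε : ε ∈ Set.Ioo (0 : ℝ) 1)
    (ys : Fin m → ℝ) (νs : ℝ) (hνs : 0 ≤ νs)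
    (hdual : PSDle (∑ i, ys i • A i - νs • (1 : Matrix (Fin n) (Fin n) ℝ)) c)
    (T : Matrix (Fin d) (Fin m) ℝ)
    (hT1 : dotp b ys - ε * norm2 b * norm2 ys ≤ dotp (T.mulVec b) (T.mulVec ys))
    (hT2 : normInf (T.transpose.mulVec (T.mulVec ys) - ys) ≤ ε * norm2 ys)
    (mu : ℝ) (hmu : mu = ε * norm2 ys * ATnorm A) :
    ∃ z : Fin d → ℝ, ∃ ν : ℝ, 0 ≤ ν ∧
      PSDle (∑ i, (T.transpose.mulVec z) i • A i - ν • (1 : Matrix (Fin n) (Fin n) ℝ))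
        (c + mu • (1 : Matrix (Fin n) (Fin n) ℝ)) ∧
      (dotp b ys - θ * νs) - ε * norm2 b * norm2 ys ≤ dotp (T.mulVec b) z - θ * ν := by
  refine ⟨T.mulVec ys, νs, hνs, ?_, by linarith⟩
  set w := T.transpose.mulVec (T.mulVec ys) - ys with hw
  have hr : 0 ≤ ε * norm2 ys := mul_nonneg hε.1.le (aux_norm2_nonneg _)
  have hP : (mu • (1 : Matrix (Fin n) (Fin n) ℝ) - ∑ i, w i • A i).PosSemidef := by
    refine Matrix.PosSemidef.of_dotProduct_mulVec_nonneg ?_ fun u => ?_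
    · change Matrix.conjTranspose _ = _
      rw [Matrix.conjTranspose_eq_transpose_of_trivial]
      simp [Matrix.transpose_sub, Matrix.transpose_sum, fun i => (hA i).eq]
    · have := aux_main A w _ hr hT2 u
      have h2 : u ⬝ᵥ u = norm2 u ^ 2 := by
        rw [aux_norm2_sq]
        simp [dotProduct, sq]
      rw [star_trivial, Matrix.sub_mulVec, Matrix.smul_mulVec, Matrix.one_mulVec,
        dotProduct_sub, dotProduct_smul, h2, smul_eq_mul, hmu]
      linarith
  have := Matrix.PosSemidef.add hdual hP
  unfold PSDle
  convert this using 1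
  simp only [hw, Pi.sub_apply, sub_smul, Finset.sum_sub_distrib]
  abel
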